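/- arXiv:1207.3664 — 2 statements merged into one kernel-verified Lean document; each statement's English description precedes it below -/
import Mathlib

section
/- Let λ, μ > 0 and ρ = λ/μ. Let ε : [0,∞) → ℝ be differentiable with ε(0) = 0, with derivative ε' positive and nonincreasing on [0,∞), and suppose that for all t ≥ 0 the equation ρ = ε'(t)/μ + ∫_0^t ε'(z)·exp(−ε(t−z)) dz holds. Then for all t ≥ 0: ρ − ε(t)·exp(−ε(t)) ≤ ε'(t)·[1/μ + ∫_0^t exp(−ε(z)) dz] ≤ ρ. -/
open MeasureTheory intervalIntegral Set in
/-- If `f + mu * (f ∗ g)` is constant and `f` is nonincreasing, then `f ∗ g` is nondecreasing, which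
bounds the decrements of `g` weighted by `f`. -/
lemma integral_mul_sub_le_of_volterra {f g : ℝ → ℝ} {lam mu : ℝ} (hmu : 0 < mu)
    (hf : Antitone f) (hgc : Continuous g)
    (heq : ∀ t, 0 ≤ t → f t + mu * ∫ z in (0 : ℝ)..t, f z * g (t - z) = lam)
    {s t : ℝ} (hs : 0 ≤ s) (hst : s ≤ t) :
    ∫ z in (0 : ℝ)..s, f z * (g (s - z) - g (t - z)) ≤ ∫ z in s..t, f z * g (t - z) := by
  have hI : ∀ a b c, IntervalIntegrable (fun z => f z * g (c - z)) volume a b := fun a b c =>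
    hf.intervalIntegrable.mul_continuousOn (by fun_prop)
  have h1 : ∫ z in (0 : ℝ)..s, f z * (g (s - z) - g (t - z)) =
      (∫ z in (0 : ℝ)..s, f z * g (s - z)) - ∫ z in (0 : ℝ)..s, f z * g (t - z) := by
    rw [← integral_sub (hI _ _ _) (hI _ _ _)]
    simp only [mul_sub]
  have h2 := integral_add_adjacent_intervals (hI 0 s t) (hI s t t)
  have h3 := heq s hs
  have h4 := heq t (hs.trans hst)
  have h5 : mu * (∫ z in (0 : ℝ)..s, f z * g (s - z)) ≤
      mu * ∫ z in (0 : ℝ)..t, f z * g (t - z) := by linarith [hf hst]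
  linarith [le_of_mul_le_mul_left h5 hmu]

open MeasureTheory intervalIntegral Set in
lemma sub_le_of_volterra {f g : ℝ → ℝ} {lam mu : ℝ} (hmu : 0 < mu)
    (hf : Antitone f) (hf0 : ∀ t, 0 ≤ f t) (hgc : Continuous g) (hg : Antitone g)
    (hg1 : g 0 = 1)
    (heq : ∀ t, 0 ≤ t → f t + mu * ∫ z in (0 : ℝ)..t, f z * g (t - z) = lam)
    {s t : ℝ} (hs : 0 ≤ s) (hst : s ≤ t) :
    f s - f t ≤ mu * f 0 * (t - s) := by
  have hI : ∀ a b c, IntervalIntegrable (fun z => f z * g (c - z)) volume a b := fun a b c =>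
    hf.intervalIntegrable.mul_continuousOn (by fun_prop)
  have h2 := integral_add_adjacent_intervals (hI 0 s t) (hI s t t)
  have h3 := heq s hs
  have h4 := heq t (hs.trans hst)
  have h5 : ∫ z in (0 : ℝ)..s, f z * g (t - z) ≤ ∫ z in (0 : ℝ)..s, f z * g (s - z) :=
    integral_mono_on hs (hI _ _ _) (hI _ _ _) fun z _ =>
      mul_le_mul_of_nonneg_left (hg (by linarith)) (hf0 z)
  have h6 : ∫ z in s..t, f z * g (t - z) ≤ ∫ _ in s..t, f 0 := by
    refine integral_mono_on hst (hI _ _ _) intervalIntegrable_const fun z hz => ?_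
    have ha : f z ≤ f 0 := hf (hs.trans hz.1)
    have hb : g (t - z) ≤ 1 := hg1 ▸ hg (by linarith [hz.2])
    nlinarith [hf0 z]
  rw [intervalIntegral.integral_const, smul_eq_mul] at h6
  calc f s - f t = mu * ((∫ z in (0 : ℝ)..t, f z * g (t - z)) -
        ∫ z in (0 : ℝ)..s, f z * g (s - z)) := by linarith
    _ ≤ mu * ((t - s) * f 0) := by gcongr; linarith
    _ = _ := by ring

lemma continuous_of_antitone_of_sub_le {f : ℝ → ℝ} (hf : Antitone f) {C : ℝ}
    (h : ∀ s t, s ≤ t → f s - f t ≤ C * (t - s)) : Continuous f := by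
  refine (LipschitzWith.of_dist_le_mul (K := Real.toNNReal C) fun s t => ?_).continuous
  have hC : C ≤ Real.toNNReal C := Real.le_coe_toNNReal C
  rw [Real.dist_eq, Real.dist_eq]
  rcases le_total s t with hst | hst
  · rw [abs_of_nonneg (by linarith [hf hst]), abs_of_nonpos (by linarith)]
    nlinarith [h s t hst]
  · rw [abs_of_nonpos (by linarith [hf hst]), abs_of_nonneg (by linarith)]
    nlinarith [h t s hst]

open MeasureTheory intervalIntegral Set in
/-- The limiting form of `integral_mul_sub_le_of_volterra` when `g' = -f g`. -/
lemma integral_mul_le_of_volterra {f g : ℝ → ℝ} {lam mu : ℝ} (hmu : 0 < mu)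
    (hf : Antitone f) (hfc : Continuous f) (hf0 : ∀ t, 0 ≤ f t)
    (hgc : Continuous g) (hg : Antitone g) (hg0 : ∀ t, 0 ≤ g t) (hg1 : g 0 = 1)
    (hconv : ∀ a b, 0 ≤ a → a ≤ b → (b - a) * (f b * g b) ≤ g a - g b)
    (heq : ∀ t, 0 ≤ t → f t + mu * ∫ z in (0 : ℝ)..t, f z * g (t - z) = lam)
    {t : ℝ} (ht : 0 < t) :
    ∫ z in (0 : ℝ)..t, f z * (f (t - z) * g (t - z)) ≤ f t := by
  have hI : ∀ a b, IntervalIntegrable (fun z => f z * (f (t - z) * g (t - z))) volume a b :=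
    fun a b => Continuous.intervalIntegrable (by fun_prop) a b
  have key : ∀ s ∈ Ico 0 t, ∫ z in (0 : ℝ)..t, f z * (f (t - z) * g (t - z)) ≤
      f s + (t - s) * (f 0 * f 0) := by
    intro s hs
    have hts : 0 < t - s := sub_pos.2 hs.2
    have h1 : (t - s) * ∫ z in (0 : ℝ)..s, f z * (f (t - z) * g (t - z)) ≤ (t - s) * f s :=
      calc (t - s) * ∫ z in (0 : ℝ)..s, f z * (f (t - z) * g (t - z))
          = ∫ z in (0 : ℝ)..s, (t - s) * (f z * (f (t - z) * g (t - z))) :=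
            (intervalIntegral.integral_const_mul _ _).symm
        _ ≤ ∫ z in (0 : ℝ)..s, f z * (g (s - z) - g (t - z)) := by
            refine integral_mono_on hs.1 (Continuous.intervalIntegrable (by fun_prop) _ _)
              (Continuous.intervalIntegrable (by fun_prop) _ _) fun z hz => ?_
            have := mul_le_mul_of_nonneg_left
              (hconv (s - z) (t - z) (by linarith [hz.2]) (by linarith)) (hf0 z)
            linarith
        _ ≤ ∫ z in s..t, f z * g (t - z) :=
            integral_mul_sub_le_of_volterra hmu hf hgc heq hs.1 hs.2.le
        _ ≤ ∫ _ in s..t, f s := by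
            refine integral_mono_on hs.2.le (Continuous.intervalIntegrable (by fun_prop) _ _)
              intervalIntegrable_const fun z hz => ?_
            have ha : f z ≤ f s := hf hz.1
            have hb : g (t - z) ≤ 1 := hg1 ▸ hg (by linarith [hz.2])
            nlinarith [hf0 z, hg0 (t - z)]
        _ = (t - s) * f s := by rw [intervalIntegral.integral_const, smul_eq_mul]
    have h2 : ∫ z in s..t, f z * (f (t - z) * g (t - z)) ≤ ∫ _ in s..t, f 0 * f 0 := by
      refine integral_mono_on hs.2.le (hI _ _) intervalIntegrable_const fun z hz => ?_
      have ha : f z ≤ f 0 := hf (hs.1.trans hz.1)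
      have hb : g (t - z) ≤ 1 := hg1 ▸ hg (by linarith [hz.2])
      have hc : f (t - z) ≤ f 0 := hf (by linarith [hz.2])
      have hd : f (t - z) * g (t - z) ≤ f 0 := by nlinarith [hf0 (t - z), hg0 (t - z)]
      exact mul_le_mul ha hd (mul_nonneg (hf0 _) (hg0 _)) (hf0 0)
    rw [intervalIntegral.integral_const, smul_eq_mul] at h2
    have h3 := le_of_mul_le_mul_left h1 hts
    linarith [integral_add_adjacent_intervals (hI 0 s) (hI s t)]
  have hlim : Filter.Tendsto (fun s => f s + (t - s) * (f 0 * f 0)) (nhdsWithin t (Iio t))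
      (nhds (f t)) := by
    have hc : Continuous fun s => f s + (t - s) * (f 0 * f 0) := by fun_prop
    simpa using (hc.tendsto t).mono_left nhdsWithin_le_nhds
  exact ge_of_tendsto hlim (Filter.mem_of_superset (Ico_mem_nhdsLT ht) key)

open MeasureTheory intervalIntegral Set in
lemma convolution_le_of_volterra {f g : ℝ → ℝ} {lam mu : ℝ} (hmu : 0 < mu)
    (hf : Antitone f) (hfc : Continuous f) (hf0 : ∀ t, 0 ≤ f t)
    (hgc : Continuous g) (hg : Antitone g) (hg0 : ∀ t, 0 ≤ g t) (hg1 : g 0 = 1)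
    (hconv : ∀ a b, 0 ≤ a → a ≤ b →
      (b - a) * (f b * g b) ≤ g a - g b ∧ g a - g b ≤ (b - a) * (f a * g a))
    (hint : ∀ t, 0 ≤ t → ∫ z in (0 : ℝ)..t, f z * g z = 1 - g t)
    (heq : ∀ t, 0 ≤ t → f t + mu * ∫ z in (0 : ℝ)..t, f z * g (t - z) = lam)
    {t : ℝ} (ht : 0 ≤ t) :
    ∫ z in (0 : ℝ)..t, f z * g (t - z) ≤
      (∫ z in (0 : ℝ)..t, f z) * g t + f t * ∫ z in (0 : ℝ)..t, g z := by
  rcases ht.eq_or_lt with rfl | htp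
  · simp
  have hA := integral_mul_le_of_volterra hmu hf hfc hf0 hgc hg hg0 hg1
    (fun a b ha hab => (hconv a b ha hab).1) heq htp
  have hI : ∀ F : ℝ → ℝ, Continuous F → IntervalIntegrable F volume 0 t := fun F hF =>
    hF.intervalIntegrable _ _
  have hrefl : ∫ z in (0 : ℝ)..t, g (t - z) = ∫ z in (0 : ℝ)..t, g z := by
    rw [integral_comp_sub_left g t]; simp
  have hrefl' : ∫ z in (0 : ℝ)..t, f (t - z) * g (t - z) = 1 - g t := by
    rw [integral_comp_sub_left (fun z => f z * g z) t, ← hint t ht]; simp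
  have hmono : ∫ z in (0 : ℝ)..t, f z * g (t - z) ≤
      ∫ z in (0 : ℝ)..t, (f z * g t + f t * g (t - z) - f t * g t +
        (t * (f z * (f (t - z) * g (t - z))) - t * f t * (f (t - z) * g (t - z)))) := by
    refine integral_mono_on ht (hI _ (by fun_prop)) (hI _ (by fun_prop)) fun z hz => ?_
    have h1 := (hconv (t - z) t (by linarith [hz.2]) (by linarith [hz.1])).2
    have h2 : 0 ≤ f z - f t := sub_nonneg.2 (hf hz.2)
    have h3 : 0 ≤ f (t - z) * g (t - z) := mul_nonneg (hf0 _) (hg0 _)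
    have h4 : g (t - z) - g t ≤ t * (f (t - z) * g (t - z)) := by nlinarith [hz.2]
    nlinarith [mul_le_mul_of_nonneg_left h4 h2]
  rw [integral_add (hI _ (by fun_prop)) (hI _ (by fun_prop)),
    integral_sub (hI _ (by fun_prop)) (hI _ (by fun_prop)),
    integral_sub (hI _ (by fun_prop)) (hI _ (by fun_prop)),
    integral_add (hI _ (by fun_prop)) (hI _ (by fun_prop)),
    intervalIntegral.integral_mul_const, intervalIntegral.integral_const_mul,
    intervalIntegral.integral_const_mul, intervalIntegral.integral_const_mul,
    intervalIntegral.integral_const_mul, hrefl, hrefl', intervalIntegral.integral_const, smul_eq_mul] at hmono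
  nlinarith [mul_le_mul_of_nonneg_left hA ht]


/-- If `ε` is differentiable on `[0,∞)` with `ε 0 = 0`, derivative
`ε'` positive and nonincreasing, and `ρ = ε' t / μ + ∫_0^t ε' z * exp (-(ε (t-z))) dz`
for all `t ≥ 0` (with `ρ = λ/μ`), then for all `t ≥ 0`:
`ρ - ε t * exp (-(ε t)) ≤ ε' t * (1/μ + ∫_0^t exp (-(ε z)) dz) ≤ ρ`. -/
theorem stmt_3 (lam mu : ℝ) (hlam : 0 < lam) (hmu : 0 < mu)
    (ε ε' : ℝ → ℝ)
    (hderiv : ∀ t ∈ Set.Ici (0 : ℝ), HasDerivWithinAt ε (ε' t) (Set.Ici 0) t)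
    (hε0 : ε 0 = 0)
    (hpos : ∀ t ∈ Set.Ici (0 : ℝ), 0 < ε' t)
    (hanti : AntitoneOn ε' (Set.Ici 0))
    (heq : ∀ t ∈ Set.Ici (0 : ℝ),
      lam / mu = ε' t / mu + ∫ z in (0 : ℝ)..t, ε' z * Real.exp (-(ε (t - z)))) :
    ∀ t ∈ Set.Ici (0 : ℝ),
      lam / mu - ε t * Real.exp (-(ε t)) ≤
          ε' t * (1 / mu + ∫ z in (0 : ℝ)..t, Real.exp (-(ε z))) ∧
        ε' t * (1 / mu + ∫ z in (0 : ℝ)..t, Real.exp (-(ε z))) ≤ lam / mu := by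
  set f : ℝ → ℝ := fun t => ε' (max t 0) with hf_def
  set g : ℝ → ℝ := fun t => Real.exp (-(ε (max t 0))) with hg_def
  have hfe : ∀ t, 0 ≤ t → f t = ε' t := fun t ht => by simp [hf_def, ht]
  have hge : ∀ t, 0 ≤ t → g t = Real.exp (-(ε t)) := fun t ht => by simp [hg_def, ht]
  have hf : Antitone f := fun a b hab =>
    hanti (le_max_right a 0) (le_max_right b 0) (max_le_max_right 0 hab)
  have hf0 : ∀ t, 0 ≤ f t := fun t => (hpos _ (le_max_right t 0)).le
  have hεc : ContinuousOn ε (Set.Ici 0) := fun t ht => (hderiv t ht).continuousWithinAt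
  have hεi : ∀ t, 0 < t → HasDerivAt ε (ε' t) t := fun t ht =>
    (hderiv t ht.le).hasDerivAt (Ici_mem_nhds ht)
  have hεm : MonotoneOn ε (Set.Ici 0) := by
    refine monotoneOn_of_deriv_nonneg (convex_Ici 0) hεc ?_ ?_ <;> rw [interior_Ici]
    · exact fun t ht => (hεi t ht).differentiableAt.differentiableWithinAt
    · exact fun t ht => (hεi t ht).deriv ▸ (hpos t (Set.Ioi_subset_Ici_self ht)).le
  have hgc : Continuous g := by
    have : Continuous fun t : ℝ => ε (max t 0) :=
      hεc.comp_continuous (by fun_prop) fun t => le_max_right t 0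
    exact Real.continuous_exp.comp this.neg
  have hg : Antitone g := fun a b hab => Real.exp_le_exp.2 <| neg_le_neg <|
    hεm (le_max_right a 0) (le_max_right b 0) (max_le_max_right 0 hab)
  have hg0 : ∀ t, 0 ≤ g t := fun t => (Real.exp_pos _).le
  have hg1 : g 0 = 1 := by simp [hg_def, hε0]
  have hgi : ∀ t, 0 < t → HasDerivAt g (-(f t * g t)) t := fun t ht => by
    have h := (hεi t ht).neg.exp
    rw [hfe t ht.le, hge t ht.le]
    refine (h.congr_of_eventuallyEq ?_).congr_deriv (by simp; ring)
    filter_upwards [Ioi_mem_nhds ht] with s hs using hge s (le_of_lt hs)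
  have hconvo : ∀ t, 0 ≤ t → ∫ z in (0 : ℝ)..t, f z * g (t - z) =
      ∫ z in (0 : ℝ)..t, ε' z * Real.exp (-(ε (t - z))) := fun t ht => by
    refine intervalIntegral.integral_congr fun z hz => ?_
    rw [Set.uIcc_of_le ht] at hz
    simp only [hfe z hz.1, hge (t - z) (by linarith [hz.2])]
  have heq' : ∀ t, 0 ≤ t → f t + mu * ∫ z in (0 : ℝ)..t, f z * g (t - z) = lam :=
    fun t ht => by
    have h := heq t ht
    rw [hconvo t ht, hfe t ht]
    field_simp at h
    linarith
  have hfc : Continuous f := by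
    refine continuous_of_antitone_of_sub_le hf (C := mu * f 0) fun s t hst => ?_
    have h := sub_le_of_volterra hmu hf hf0 hgc hg hg1 heq'
      (le_max_right s 0) (max_le_max_right 0 hst)
    have h1 : f (max s 0) = f s := by simp [hf_def]
    have h2 : f (max t 0) = f t := by simp [hf_def]
    rw [h1, h2] at h
    refine h.trans (mul_le_mul_of_nonneg_left ?_ (mul_nonneg hmu.le (hf0 0)))
    rcases le_total s 0 with hs | hs <;> rcases le_total t 0 with ht | ht <;>
      simp [hs, ht] <;> linarith
  have hconv : ∀ a b, 0 ≤ a → a ≤ b →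
      (b - a) * (f b * g b) ≤ g a - g b ∧ g a - g b ≤ (b - a) * (f a * g a) := by
    intro a b ha hab
    rcases hab.eq_or_lt with rfl | hlt
    · simp
    obtain ⟨c, hc, h⟩ := exists_hasDerivAt_eq_slope g (fun t => -(f t * g t)) hlt
      hgc.continuousOn fun x hx => hgi x (ha.trans_lt hx.1)
    rw [eq_div_iff (sub_pos.2 hlt).ne'] at h
    have hgap : g a - g b = (b - a) * (f c * g c) := by linarith
    rw [hgap]
    have hba : 0 ≤ b - a := sub_nonneg.2 hab
    exact ⟨mul_le_mul_of_nonneg_left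
        (mul_le_mul (hf hc.2.le) (hg hc.2.le) (hg0 _) (hf0 _)) hba,
      mul_le_mul_of_nonneg_left
        (mul_le_mul (hf hc.1.le) (hg hc.1.le) (hg0 _) (hf0 _)) hba⟩
  have hint : ∀ t, 0 ≤ t → ∫ z in (0 : ℝ)..t, f z * g z = 1 - g t := fun t ht => by
    have h := intervalIntegral.integral_eq_sub_of_hasDerivAt_of_le ht
      hgc.continuousOn (fun x hx => hgi x hx.1)
      (Continuous.intervalIntegrable (by fun_prop) 0 t)
    rw [intervalIntegral.integral_neg, hg1] at h
    linarith
  intro t ht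
  have ht : (0 : ℝ) ≤ t := ht
  have hlow := convolution_le_of_volterra hmu hf hfc hf0 hgc hg hg0 hg1 hconv hint heq' ht
  have hε : ∫ z in (0 : ℝ)..t, f z = ε t := by
    rw [intervalIntegral.integral_eq_sub_of_hasDerivAt_of_le ht
      (hεc.mono Set.Icc_subset_Ici_self)
      (fun x hx => by rw [hfe x hx.1.le]; exact hεi x hx.1)
      (hfc.intervalIntegrable 0 t), hε0, sub_zero]
  have hJ : ∫ z in (0 : ℝ)..t, g z = ∫ z in (0 : ℝ)..t, Real.exp (-(ε z)) := by
    refine intervalIntegral.integral_congr fun z hz => ?_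
    rw [Set.uIcc_of_le ht] at hz
    exact hge z hz.1
  have hup : f t * ∫ z in (0 : ℝ)..t, g z ≤ ∫ z in (0 : ℝ)..t, f z * g (t - z) := by
    have hrefl : ∫ z in (0 : ℝ)..t, g (t - z) = ∫ z in (0 : ℝ)..t, g z := by
      rw [intervalIntegral.integral_comp_sub_left g t]; simp
    rw [← hrefl, ← intervalIntegral.integral_const_mul]
    exact intervalIntegral.integral_mono_on ht
      (Continuous.intervalIntegrable (by fun_prop) _ _)
      (Continuous.intervalIntegrable (by fun_prop) _ _)
      fun z hz => mul_le_mul_of_nonneg_right (hf hz.2) (hg0 _)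
  rw [hε, hJ, hconvo t ht, hge t ht, hfe t ht] at hlow
  rw [hJ, hconvo t ht, hfe t ht] at hup
  rw [mul_add, mul_one_div, heq t ht]
  constructor <;> linarith
end

section
/- Let λ, μ > 0 and ρ = λ/μ. Define sequences (a_k, b_k) by a_0 = μ/(λ+μ), b_0 = λ+μ, and for k ≥ 0: a_{k+1}·b_{k+1} = μ·exp(−λ·a_k/b_k) and b_{k+1}·(1 − a_{k+1}) = λ·(1 − a_k) (equivalently b_{k+1} = μ·e^{−λ a_k/b_k} + λ(1−a_k) and a_{k+1} = μ·e^{−λ a_k/b_k}/b_{k+1}). Then the sequences are well defined with 0 < a_k ≤ 1 and b_k > 0, the limits a = lim_k a_k and b = lim_k b_k exist, and: if ρ ≤ 1/e then a = 1 and b = λ/r, where r is the smallest root in (0,1] of r·e^{−r} = ρ; if ρ ≥ 1/e then a = x and b = λ, where x ≤ 1 is the unique positive root of x·e^{x} = 1/ρ. -/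
open Filter Topology

/-- The normalised iteration: `α = a`, `β = b / λ`, `c = μ / λ`. -/
structure LifetimeIteration (c : ℝ) (α β : ℕ → ℝ) : Prop where
  pos : 0 < c
  alpha_zero : α 0 = c / (1 + c)
  beta_zero : β 0 = 1 + c
  beta_succ : ∀ k, β (k + 1) = c * Real.exp (-(α k / β k)) + (1 - α k)
  alpha_succ : ∀ k, α (k + 1) = c * Real.exp (-(α k / β k)) / β (k + 1)

theorem mul_exp_neg_lt_mul_exp_neg {r s : ℝ} (hrs : r < s) (hs : s ≤ 1) (hs0 : 0 < s) :
    r * Real.exp (-r) < s * Real.exp (-s) := by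
  have h1 : r - s + 1 < Real.exp (r - s) := Real.add_one_lt_exp (by linarith)
  have h2 : Real.exp (-s) = Real.exp (r - s) * Real.exp (-r) := by
    rw [← Real.exp_add]; congr 1; ring
  have h3 : r < s * Real.exp (r - s) := by
    nlinarith [mul_lt_mul_of_pos_left h1 hs0, mul_nonneg (sub_nonneg.2 hrs.le) (sub_nonneg.2 hs)]
  rw [h2, ← mul_assoc]
  exact mul_lt_mul_of_pos_right h3 (Real.exp_pos _)

theorem le_one_of_mul_exp_le {x : ℝ} (h : x * Real.exp x ≤ Real.exp 1) : x ≤ 1 := by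
  by_contra! hx
  have h1 : Real.exp 1 < Real.exp x := Real.exp_lt_exp.2 hx
  nlinarith [Real.exp_pos x]

theorem lyapunov_rational_bound {x g : ℝ} (hx0 : 0 < x) (hx1 : x ≤ 1) (hg : 0 < g) :
    (2 / (2 - x + x * g ^ 2)) ^ 2 * ((1 - x) ^ 2 - x ^ 2 * g ^ 2)
      + 2 * g * (2 / (2 - x + x * g ^ 2)) - 1
      ≤ 4 * g * (1 - x ^ 2) / (2 - x ^ 2 + 2 * x * g + x ^ 2 * g ^ 2) := by
  have hd : 0 < 2 - x + x * g ^ 2 := by nlinarith [mul_pos hx0 (pow_pos hg 2)]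
  have hD : 0 < 2 - x ^ 2 + 2 * x * g + x ^ 2 * g ^ 2 := by
    nlinarith [mul_pos hx0 hg, pow_pos (mul_pos hx0 hg) 2]
  have hy : 0 ≤ 1 - x := by linarith
  have hq : 0 ≤ x * (1 - g) ^ 2 * (x ^ 3 * (1 - g ^ 2) ^ 2 + (1 - x) * (8 + 2 * x * (1 - x))
      + (1 - x) * (2 * (1 + x) * (1 - x) + 6) * g + 2 * x * (1 - x) * (1 + x) * g ^ 2
      + x * (1 - x) * (4 + 2 * x) * g ^ 3) := by positivity
  have key : (2 / (2 - x + x * g ^ 2)) ^ 2 * ((1 - x) ^ 2 - x ^ 2 * g ^ 2)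
      + 2 * g * (2 / (2 - x + x * g ^ 2)) - 1
      - 4 * g * (1 - x ^ 2) / (2 - x ^ 2 + 2 * x * g + x ^ 2 * g ^ 2)
      = -(x * (1 - g) ^ 2 * (x ^ 3 * (1 - g ^ 2) ^ 2 + (1 - x) * (8 + 2 * x * (1 - x))
      + (1 - x) * (2 * (1 + x) * (1 - x) + 6) * g + 2 * x * (1 - x) * (1 + x) * g ^ 2
      + x * (1 - x) * (4 + 2 * x) * g ^ 3))
      / ((2 - x + x * g ^ 2) ^ 2 * (2 - x ^ 2 + 2 * x * g + x ^ 2 * g ^ 2)) := by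
    field_simp
    ring
  have := div_nonneg hq
    (mul_pos (pow_pos hd 2) hD).le
  rw [neg_div] at key
  linarith

theorem lyapunov_sqrt_bound {x g : ℝ} (hx0 : 0 < x) (hx1 : x ≤ 1) (hg : 0 < g) :
    2 * x * g ^ 2 - 2 * g * √(1 - x ^ 2 + x ^ 2 * g ^ 2)
      ≤ -(4 * g * (1 - x ^ 2) / (2 - x ^ 2 + 2 * x * g + x ^ 2 * g ^ 2)) := by
  have hx2 : 0 ≤ 1 - x ^ 2 := by nlinarith
  set S := 1 - x ^ 2 + x ^ 2 * g ^ 2 with hS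
  have hS0 : 0 < S := by nlinarith [pow_pos (mul_pos hx0 hg) 2]
  have hs := Real.sq_sqrt hS0.le
  have hsp := Real.sqrt_pos.2 hS0
  have hD : 0 < 2 - x ^ 2 + 2 * x * g + x ^ 2 * g ^ 2 := by
    nlinarith [mul_pos hx0 hg, pow_pos (mul_pos hx0 hg) 2]
  have hxg := mul_pos hx0 hg
  have h1 : 2 * (√S + x * g) ≤ 2 - x ^ 2 + 2 * x * g + x ^ 2 * g ^ 2 := by
    nlinarith [sq_nonneg (√S - 1)]
  have h2 : (√S - x * g) * (√S + x * g) = 1 - x ^ 2 := by nlinarith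
  have h3 : 0 ≤ √S - x * g := by
    by_contra! h
    nlinarith
  have h4 : 4 * g * (1 - x ^ 2) / (2 - x ^ 2 + 2 * x * g + x ^ 2 * g ^ 2)
      ≤ 2 * g * (√S - x * g) := by
    rw [div_le_iff₀ hD]
    nlinarith [mul_le_mul_of_nonneg_left h1 (mul_nonneg hg.le h3)]
  linarith

theorem lyapunov_exp_bound {x g : ℝ} (hx0 : 0 < x) (hx1 : x ≤ 1) (hg : 0 < g) :
    Real.exp (x - x * g ^ 2) * ((1 - x) ^ 2 - x ^ 2 * g ^ 2) + x * g ^ 2 + 2 * Real.log g + 1 + x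
      - 2 * g * √(1 - x ^ 2 + x ^ 2 * g ^ 2) ≤ 0 := by
  have hd : 0 < 2 - x + x * g ^ 2 := by nlinarith [mul_pos hx0 (pow_pos hg 2)]
  have h1 := lyapunov_rational_bound hx0 hx1 hg
  have h2 := lyapunov_sqrt_bound hx0 hx1 hg
  set e := Real.exp (x * (1 - g ^ 2) / 2) with he
  have he0 : 0 < e := Real.exp_pos _
  have hE : Real.exp (x - x * g ^ 2) = e ^ 2 := by
    rw [he, pow_two (Real.exp _), ← Real.exp_add]; congr 1; ring
  have hlog : Real.log g + x * (1 - g ^ 2) / 2 ≤ g * e - 1 := by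
    have := Real.log_le_sub_one_of_pos (mul_pos hg he0)
    rwa [Real.log_mul hg.ne' he0.ne', he, Real.log_exp] at this
  set f := 2 / (2 - x + x * g ^ 2) with hf
  have hef : e ≤ f := by
    have h3 : 1 - x * (1 - g ^ 2) / 2 ≤ Real.exp (-(x * (1 - g ^ 2) / 2)) :=
      Real.one_sub_le_exp_neg _
    have h4 : e * Real.exp (-(x * (1 - g ^ 2) / 2)) = 1 := by
      rw [he, ← Real.exp_add, add_neg_cancel, Real.exp_zero]
    rw [hf, le_div_iff₀ hd]
    nlinarith [mul_le_mul_of_nonneg_left h3 he0.le]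
  have hf1 : x ^ 2 * g * f ≤ 1 := by
    rw [hf, mul_div_assoc', div_le_one hd]
    have : x ^ 3 ≤ 1 := pow_le_one₀ hx0.le hx1
    nlinarith [mul_nonneg hx0.le (sq_nonneg (g - x))]
  have hmono : e ^ 2 * ((1 - x) ^ 2 - x ^ 2 * g ^ 2) + 2 * g * e
      ≤ f ^ 2 * ((1 - x) ^ 2 - x ^ 2 * g ^ 2) + 2 * g * f := by
    have h5 : x ^ 2 * g * e ≤ x ^ 2 * g * f := by gcongr
    have h6 : 0 ≤ ((1 - x) ^ 2 - x ^ 2 * g ^ 2) * (f + e) + 2 * g := by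
      have : 0 ≤ (1 - x) ^ 2 * (f + e) := by positivity
      nlinarith
    nlinarith [mul_nonneg (sub_nonneg.2 hef) h6]
  rw [hE]
  linarith

theorem sub_one_le_mul_log {m : ℝ} (hm : 0 < m) : m - 1 ≤ m * Real.log m := by
  have := mul_le_mul_of_nonneg_left (Real.one_sub_inv_le_log_of_pos hm) hm.le
  rwa [mul_sub, mul_one, mul_inv_cancel₀ hm.ne'] at this

theorem lyapunov_drift_sq {x g m : ℝ} (hx0 : 0 < x) (hx1 : x ≤ 1) (hg : 0 < g) (hm : 0 < m) :
    Real.exp (x - x * g ^ 2) * ((1 - x) ^ 2 - x ^ 2 * g ^ 2) + x * g ^ 2 + 2 * Real.log g + 1 - x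
      + m ^ 2 * (x ^ 2 + 2 * x - 1) - 4 * x * m ^ 2 * Real.log m - x ^ 2 * m ^ 2 * g ^ 2
      - g ^ 2 / m ^ 2 ≤ -(2 * x * (m - 1) ^ 2) := by
  have h1 := lyapunov_exp_bound hx0 hx1 hg
  have hx2 : 0 ≤ 1 - x ^ 2 := by nlinarith
  set S := 1 - x ^ 2 + x ^ 2 * g ^ 2 with hS
  have hS0 : 0 ≤ S := by positivity
  have h2 : 2 * g * √S ≤ m ^ 2 * S + g ^ 2 / m ^ 2 := by
    have h3 := sq_nonneg (m * √S - g / m)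
    have h4 : (m * √S - g / m) ^ 2 = m ^ 2 * (√S) ^ 2 + g ^ 2 / m ^ 2 - 2 * g * √S := by
      field_simp
      ring
    rw [h4, Real.sq_sqrt hS0] at h3
    linarith
  have h5 : 4 * x * m * (m - 1) ≤ 4 * x * m * (m * Real.log m) := by
    have := sub_one_le_mul_log hm
    gcongr
  nlinarith

theorem lyapunov_drift {x α t : ℝ} (hx0 : 0 < x) (hx1 : x ≤ 1) (hα : 0 < α) (ht : 0 < t) :
    Real.exp (x - t) * ((1 - x) ^ 2 - x * t) + t + Real.log t + 1 - x - Real.log x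
      + α * (x + 2 * Real.log x - 1 / x + 2) - 2 * α * Real.log α - α * t - t / α
      ≤ -(2 * x * (√(α / x) - 1) ^ 2) := by
  have hg : 0 < √(t / x) := Real.sqrt_pos.2 (by positivity)
  have hm : 0 < √(α / x) := Real.sqrt_pos.2 (by positivity)
  have h := lyapunov_drift_sq hx0 hx1 hg hm
  have e1 : √(t / x) ^ 2 = t / x := Real.sq_sqrt (by positivity)
  have e2 : √(α / x) ^ 2 = α / x := Real.sq_sqrt (by positivity)
  rw [e1, e2, Real.log_sqrt (by positivity), Real.log_sqrt (by positivity),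
    Real.log_div ht.ne' hx0.ne', Real.log_div hα.ne' hx0.ne', mul_div_cancel₀ _ hx0.ne'] at h
  convert h using 1
  field_simp
  ring

/-- The Lyapunov function whose value at `(α k, β k)` decreases along the iteration when `c = x e^x`
with `x ≤ 1`. -/
noncomputable def lyapunov (x α β : ℝ) : ℝ :=
  (α * (Real.log α + Real.log β - Real.log x) + (1 - 2 * x) * α / x + 1 / β) / (1 - α)
    - Real.log α + 2 * Real.log (1 - α) + Real.log β

theorem one_add_log_le {κ z : ℝ} (hκ : 0 < κ) (hz : 0 < z) :
    1 + Real.log κ ≤ κ * z - Real.log z := by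
  have := Real.log_le_sub_one_of_pos (mul_pos hκ hz)
  rw [Real.log_mul hκ.ne' hz.ne'] at this
  linarith

theorem lyapunov_lower_bound {x α β : ℝ} (hx0 : 0 < x) (hx1 : x < 1) (hα : 0 < α) (hα1 : α < 1)
    (hβ : 0 < β) :
    (1 + Real.log ((1 - x) / x)) + (1 + Real.log (1 - x)) ≤ lyapunov x α β := by
  have hs : 0 < 1 - α := by linarith
  have hx : 0 < 1 - x := by linarith
  have h1 := one_add_log_le (κ := (1 - x) / x) (z := α / (1 - α)) (by positivity) (by positivity)
  have h2 := one_add_log_le (κ := 1 - x) (z := 1 / ((1 - α) * β)) (by positivity) (by positivity)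
  have h3 := sub_one_le_mul_log (m := α * β / x) (by positivity)
  rw [Real.log_div hα.ne' hs.ne'] at h1
  rw [Real.log_div one_ne_zero (by positivity), Real.log_one, Real.log_mul hs.ne' hβ.ne'] at h2
  rw [Real.log_div (by positivity) hx0.ne', Real.log_mul hα.ne' hβ.ne'] at h3
  have h4 := mul_le_mul_of_nonneg_left h3 (show 0 ≤ x / ((1 - α) * β) by positivity)
  have h5 : lyapunov x α β
      = (x / ((1 - α) * β)) * (α * β / x * (Real.log α + Real.log β - Real.log x))
        - (x / ((1 - α) * β)) * (α * β / x - 1)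
        + ((1 - x) / x * (α / (1 - α)) - (Real.log α - Real.log (1 - α)))
        + ((1 - x) * (1 / ((1 - α) * β)) - (0 - (Real.log (1 - α) + Real.log β))) := by
    unfold lyapunov
    field_simp
    ring
  linarith

theorem lyapunov_step {x α β α' β' : ℝ} (hx0 : 0 < x) (hx1 : x < 1) (hα : 0 < α) (hα1 : α < 1)
    (hβ : 0 < β) (hα' : 0 < α') (hα1' : α' < 1) (hβ' : 0 < β')
    (hp : α' * β' = x * Real.exp x * Real.exp (-(α / β))) (hs : β' * (1 - α') = 1 - α) :
    lyapunov x α' β' ≤ lyapunov x α β - 2 * x * (√(α / x) - 1) ^ 2 := by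
  have hσ : 0 < 1 - α := by linarith
  have hσ' : 0 < 1 - α' := by linarith
  set t := α / β with ht
  have ht0 : 0 < t := by positivity
  have hp' : α' * β' = x * Real.exp (x - t) := by
    rw [hp, mul_assoc, ← Real.exp_add]; rfl
  have hl1 : Real.log α' + Real.log β' = Real.log x + (x - t) := by
    rw [← Real.log_mul hα'.ne' hβ'.ne', hp', Real.log_mul hx0.ne' (Real.exp_pos _).ne',
      Real.log_exp]
  have hl2 : Real.log β' + Real.log (1 - α') = Real.log (1 - α) := by
    rw [← Real.log_mul hβ'.ne' hσ'.ne', hs]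
  have hl3 : Real.log t = Real.log α - Real.log β := by
    rw [ht, Real.log_div hα.ne' hβ.ne']
  have hz : α' / (1 - α') = x * Real.exp (x - t) / (1 - α) := by
    rw [← hp', ← hs]; field_simp
  have hy : 1 / (β' * (1 - α')) = 1 / (1 - α) := by rw [hs]
  have hb : 1 / β = t / α := by rw [ht]; field_simp
  have e1 : lyapunov x α' β' = (α' / (1 - α')) * (Real.log α' + Real.log β' - Real.log x)
      + (1 - 2 * x) / x * (α' / (1 - α')) + 1 / (β' * (1 - α'))
      - (Real.log α' + Real.log β') + 2 * (Real.log β' + Real.log (1 - α')) := by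
    unfold lyapunov
    field_simp
    ring
  rw [hl1, hl2, hz, hy] at e1
  have e2 : lyapunov x α' β' - lyapunov x α β =
      (Real.exp (x - t) * ((1 - x) ^ 2 - x * t) + t + Real.log t + 1 - x - Real.log x
      + α * (x + 2 * Real.log x - 1 / x + 2) - 2 * α * Real.log α - α * t - t / α) / (1 - α) := by
    rw [e1, hl3]
    unfold lyapunov
    rw [hb]
    field_simp
    ring
  have hdrift := lyapunov_drift hx0 hx1.le hα ht0
  have h6 := div_le_div_of_nonneg_right hdrift hσ.le
  have h7 : 2 * x * (√(α / x) - 1) ^ 2 ≤ 2 * x * (√(α / x) - 1) ^ 2 / (1 - α) := by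
    rw [le_div_iff₀ hσ]
    nlinarith [show 0 ≤ 2 * x * (√(α / x) - 1) ^ 2 by positivity]
  rw [neg_div] at h6
  linarith

namespace LifetimeIteration

variable {c : ℝ} {α β : ℕ → ℝ}

theorem bounds (h : LifetimeIteration c α β) (k : ℕ) : 0 < α k ∧ α k < 1 ∧ 0 < β k := by
  have hc := h.pos
  induction k with
  | zero =>
    rw [h.alpha_zero, h.beta_zero]
    exact ⟨by positivity, by rw [div_lt_one (by positivity)]; linarith, by positivity⟩
  | succ k ih =>
    obtain ⟨-, h2, -⟩ := ih
    have hp : 0 < c * Real.exp (-(α k / β k)) := by positivity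
    have hb : 0 < β (k + 1) := by rw [h.beta_succ]; linarith
    refine ⟨?_, ?_, hb⟩
    · rw [h.alpha_succ]; positivity
    · rw [h.alpha_succ, div_lt_one hb, h.beta_succ]; linarith

theorem alpha_mul_beta (h : LifetimeIteration c α β) (k : ℕ) :
    α (k + 1) * β (k + 1) = c * Real.exp (-(α k / β k)) := by
  rw [h.alpha_succ, div_mul_cancel₀ _ (h.bounds (k + 1)).2.2.ne']

theorem beta_mul_one_sub (h : LifetimeIteration c α β) (k : ℕ) :
    β (k + 1) * (1 - α (k + 1)) = 1 - α k := by
  have := h.alpha_mul_beta k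
  have := h.beta_succ k
  linarith

theorem tendsto_of_lt (h : LifetimeIteration c α β) {x : ℝ} (hx0 : 0 < x) (hx1 : x < 1)
    (hx : x * Real.exp x = c) : Tendsto α atTop (𝓝 x) ∧ Tendsto β atTop (𝓝 1) := by
  set V : ℕ → ℝ := fun k => lyapunov x (α k) (β k) with hV
  have hstep (k : ℕ) : V (k + 1) ≤ V k - 2 * x * (√(α k / x) - 1) ^ 2 := by
    obtain ⟨h1, h2, h3⟩ := h.bounds k
    obtain ⟨h1', h2', h3'⟩ := h.bounds (k + 1)
    exact lyapunov_step hx0 hx1 h1 h2 h3 h1' h2' h3' (hx ▸ h.alpha_mul_beta k)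
      (h.beta_mul_one_sub k)
  have hanti : Antitone V := antitone_nat_of_succ_le fun k => by
    have := hstep k
    have : 0 ≤ 2 * x * (√(α k / x) - 1) ^ 2 := by positivity
    linarith
  have hbdd : BddBelow (Set.range V) := by
    refine ⟨(1 + Real.log ((1 - x) / x)) + (1 + Real.log (1 - x)), ?_⟩
    rintro _ ⟨k, rfl⟩
    obtain ⟨h1, h2, h3⟩ := h.bounds k
    exact lyapunov_lower_bound hx0 hx1 h1 h2 h3
  have hlim := tendsto_atTop_ciInf hanti hbdd
  have hdiff : Tendsto (fun k => (V k - V (k + 1)) / (2 * x)) atTop (𝓝 0) := by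
    have := (hlim.sub (hlim.comp (tendsto_add_atTop_nat 1))).div_const (2 * x)
    simpa using this
  have hsq : Tendsto (fun k => (√(α k / x) - 1) ^ 2) atTop (𝓝 0) := by
    refine squeeze_zero (fun k => sq_nonneg _) (fun k => ?_) hdiff
    rw [le_div_iff₀ (by positivity)]
    linarith [hstep k]
  have habs : Tendsto (fun k => √(α k / x) - 1) atTop (𝓝 0) := by
    have := hsq.sqrt
    simp only [Real.sqrt_sq_eq_abs, Real.sqrt_zero] at this
    exact (tendsto_zero_iff_abs_tendsto_zero _).2 this
  have hα : Tendsto α atTop (𝓝 x) := by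
    have := ((habs.add_const 1).pow 2).const_mul x
    simp only [sub_add_cancel, zero_add, one_pow, mul_one] at this
    refine this.congr fun k => ?_
    rw [Real.sq_sqrt (div_nonneg (h.bounds k).1.le hx0.le), mul_div_cancel₀ _ hx0.ne']
  refine ⟨hα, (tendsto_add_atTop_iff_nat 1).1 ?_⟩
  have hne : (1 : ℝ) - x ≠ 0 := by linarith
  have := (hα.const_sub 1).div ((hα.comp (tendsto_add_atTop_nat 1)).const_sub 1) hne
  rw [div_self hne] at this
  refine this.congr fun k => ?_
  have hs := (h.bounds (k + 1)).2.1
  simp only [Pi.div_apply, Function.comp_apply]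
  rw [← h.beta_mul_one_sub k, mul_div_cancel_right₀]
  linarith

theorem one_le_beta (h : LifetimeIteration c α β) (hc : Real.exp 1 ≤ c) (k : ℕ) : 1 ≤ β k := by
  induction k with
  | zero => rw [h.beta_zero]; linarith [h.pos]
  | succ k ih =>
    have hc0 := h.pos.le
    obtain ⟨h1, h2, h3⟩ := h.bounds k
    have hu : α k / β k ≤ 1 := by rw [div_le_one h3]; linarith
    have : 1 ≤ c * Real.exp (-(α k / β k)) := by
      calc (1 : ℝ) = Real.exp 1 * Real.exp (-1) := by
            rw [← Real.exp_add, add_neg_cancel, Real.exp_zero]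
        _ ≤ _ := by gcongr
    rw [h.beta_succ]
    linarith

theorem alpha_monotone (h : LifetimeIteration c α β) (hc : Real.exp 1 ≤ c) : Monotone α := by
  refine monotone_nat_of_le_succ fun k => ?_
  have h1 := h.one_le_beta hc (k + 1)
  have h2 := (h.bounds (k + 1)).2.1
  have h3 := h.beta_mul_one_sub k
  nlinarith

theorem beta_antitone (h : LifetimeIteration c α β) (hc : Real.exp 1 ≤ c) : Antitone β := by
  refine antitone_nat_of_succ_le fun k => ?_
  induction k with
  | zero =>
    obtain ⟨h1, h2, h3⟩ := h.bounds 0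
    have hc0 := h.pos
    have : Real.exp (-(α 0 / β 0)) ≤ 1 := Real.exp_le_one_iff.2 (neg_nonpos.2 (by positivity))
    rw [h.beta_succ, h.beta_zero]
    rw [h.beta_zero] at this
    nlinarith
  | succ k ih =>
    have h0 := h.pos
    have h1 := h.alpha_monotone hc (Nat.le_succ k)
    have h2 := h.bounds k
    have h3 := h.bounds (k + 1)
    have hu : α k / β k ≤ α (k + 1) / β (k + 1) := div_le_div₀ h3.1.le h1 h3.2.2 ih
    have hexp : c * Real.exp (-(α (k + 1) / β (k + 1))) ≤ c * Real.exp (-(α k / β k)) := by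
      gcongr
    have h4 := h.beta_succ (k + 1)
    have h5 := h.beta_succ k
    linarith

theorem tendsto_of_exp_one_le (h : LifetimeIteration c α β) (hc : Real.exp 1 ≤ c) :
    Tendsto α atTop (𝓝 1) ∧
      ∃ B, 1 ≤ B ∧ B = c * Real.exp (-(1 / B)) ∧ Tendsto β atTop (𝓝 B) := by
  have hα := tendsto_atTop_ciSup (h.alpha_monotone hc)
    ⟨1, by rintro _ ⟨k, rfl⟩; exact (h.bounds k).2.1.le⟩
  have hβ := tendsto_atTop_ciInf (h.beta_antitone hc)
    ⟨1, by rintro _ ⟨k, rfl⟩; exact h.one_le_beta hc k⟩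
  set A := ⨆ k, α k
  set B := ⨅ k, β k
  have hA : A ≤ 1 := le_of_tendsto' hα fun k => (h.bounds k).2.1.le
  have hA0 : 0 ≤ A := ge_of_tendsto' hα fun k => (h.bounds k).1.le
  have hB : 1 ≤ B := ge_of_tendsto' hβ fun k => h.one_le_beta hc k
  have hB0 : B ≠ 0 := by linarith
  have hα' := hα.comp (tendsto_add_atTop_nat 1)
  have hβ' := hβ.comp (tendsto_add_atTop_nat 1)
  have e1 : B * (1 - A) = 1 - A :=
    tendsto_nhds_unique ((hβ'.mul (hα'.const_sub 1)).congr fun k => h.beta_mul_one_sub k)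
      (hα.const_sub 1)
  have e2 : A * B = c * Real.exp (-(A / B)) :=
    tendsto_nhds_unique ((hα'.mul hβ').congr fun k => h.alpha_mul_beta k)
      (((Real.continuous_exp.tendsto _).comp (hα.div hβ hB0).neg).const_mul c)
  have hA1 : A = 1 := by
    by_contra hne
    have hlt : A < 1 := lt_of_le_of_ne hA hne
    have hB1 : B = 1 := by
      have : (B - 1) * (1 - A) = 0 := by linarith
      rcases mul_eq_zero.1 this with h | h <;> linarith
    rw [hB1, mul_one, div_one] at e2
    have h1 : Real.exp 1 * Real.exp (-1) = 1 := by
      rw [← Real.exp_add, add_neg_cancel, Real.exp_zero]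
    have h2 : Real.exp 1 * Real.exp (-1) ≤ c * Real.exp (-A) :=
      mul_le_mul hc (Real.exp_le_exp.2 (by linarith)) (Real.exp_pos _).le h.pos.le
    linarith
  rw [hA1] at hα e2
  exact ⟨hα, B, hB, by rwa [one_mul] at e2, hβ⟩

end LifetimeIteration

theorem exists_mul_exp_eq {c : ℝ} (hc0 : 0 < c) (hc : c < Real.exp 1) :
    ∃ x, 0 < x ∧ x < 1 ∧ x * Real.exp x = c := by
  have hcont : ContinuousOn (fun x : ℝ => x * Real.exp x) (Set.Icc 0 1) := by fun_prop
  obtain ⟨x, hx, hxc⟩ := intermediate_value_Ioo zero_le_one hcont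
    (show c ∈ Set.Ioo _ _ by simpa using ⟨hc0, hc⟩)
  exact ⟨x, hx.1, hx.2, hxc⟩


/-- Let `λ, μ > 0`, `ρ = λ/μ`, and define `a 0 = μ/(λ+μ)`,
`b 0 = λ+μ`, `b (k+1) = μ e^{-λ a_k/b_k} + λ(1 - a_k)`,
`a (k+1) = μ e^{-λ a_k/b_k} / b (k+1)` (so that
`a_{k+1} b_{k+1} = μ e^{-λ a_k/b_k}` and `b_{k+1}(1 - a_{k+1}) = λ(1 - a_k)`).
Then `0 < a_k ≤ 1`, `b_k > 0`, the limits `a = lim a_k`, `b = lim b_k` exist,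
and: if `ρ ≤ 1/e` then `a = 1`, `b = λ/r` with `r` the smallest root in `(0,1]`
of `r e^{-r} = ρ`; if `ρ ≥ 1/e` then `a = x`, `b = λ` with `x` the positive root
of `x e^x = 1/ρ`. -/
theorem stmt_19 (lam mu : ℝ) (hlam : 0 < lam) (hmu : 0 < mu)
    (a b : ℕ → ℝ)
    (ha0 : a 0 = mu / (lam + mu)) (hb0 : b 0 = lam + mu)
    (hbrec : ∀ k, b (k + 1) =
      mu * Real.exp (-(lam * a k / b k)) + lam * (1 - a k))
    (harec : ∀ k, a (k + 1) =
      mu * Real.exp (-(lam * a k / b k)) / b (k + 1)) :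
    (∀ k, 0 < a k ∧ a k ≤ 1 ∧ 0 < b k) ∧
      (∃ A : ℝ, Filter.Tendsto a Filter.atTop (nhds A)) ∧
      (∃ B : ℝ, Filter.Tendsto b Filter.atTop (nhds B)) ∧
      (lam / mu ≤ (Real.exp 1)⁻¹ →
        ∀ r : ℝ, 0 < r → r ≤ 1 → r * Real.exp (-r) = lam / mu →
          (∀ r' : ℝ, 0 < r' → r' * Real.exp (-r') = lam / mu → r ≤ r') →
          Filter.Tendsto a Filter.atTop (nhds 1) ∧
            Filter.Tendsto b Filter.atTop (nhds (lam / r))) ∧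
      ((Real.exp 1)⁻¹ ≤ lam / mu →
        ∀ x : ℝ, 0 < x → x * Real.exp x = mu / lam →
          Filter.Tendsto a Filter.atTop (nhds x) ∧
            Filter.Tendsto b Filter.atTop (nhds lam)) := by
  set β : ℕ → ℝ := fun k => b k / lam with hβdef
  have hbβ (k : ℕ) : b k = lam * β k := by simp only [hβdef]; field_simp
  have hu (k : ℕ) : lam * a k / b k = a k / β k := by
    rw [hbβ, mul_div_mul_left _ _ hlam.ne']
  have hβrec (k : ℕ) : β (k + 1) = mu / lam * Real.exp (-(a k / β k)) + (1 - a k) := by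
    rw [← hu]
    simp only [hβdef]
    rw [hbrec]
    field_simp
  have h : LifetimeIteration (mu / lam) a β :=
    { pos := by positivity
      alpha_zero := by rw [ha0]; field_simp
      beta_zero := by simp only [hβdef]; rw [hb0]; field_simp
      beta_succ := hβrec
      alpha_succ := fun k => by
        rw [harec, hu, hbβ (k + 1)]
        field_simp }
  have hc0 := h.pos
  have tendsto_b {B : ℝ} (hB : Tendsto β atTop (𝓝 B)) : Tendsto b atTop (𝓝 (lam * B)) :=
    (hB.const_mul lam).congr fun k => (hbβ k).symm
  have hlim : ∃ A B : ℝ, Tendsto a atTop (𝓝 A) ∧ Tendsto b atTop (𝓝 B) := by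
    rcases lt_or_ge (mu / lam) (Real.exp 1) with hc | hc
    · obtain ⟨x, hx0, hx1, hx⟩ := exists_mul_exp_eq hc0 hc
      exact ⟨_, _, (h.tendsto_of_lt hx0 hx1 hx).1, tendsto_b (h.tendsto_of_lt hx0 hx1 hx).2⟩
    · obtain ⟨hA, B, -, -, hB⟩ := h.tendsto_of_exp_one_le hc
      exact ⟨_, _, hA, tendsto_b hB⟩
  obtain ⟨A, B, hA, hB⟩ := hlim
  have eq_inv_of_fixed {r B : ℝ} (hr0 : 0 < r) (hr1 : r ≤ 1)
      (hr : r * Real.exp (-r) = lam / mu) (hB1 : 1 ≤ B)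
      (hB : B = mu / lam * Real.exp (-(1 / B))) : B = 1 / r := by
    have hB0 : 0 < B := by linarith
    have hq : 1 / B * Real.exp (-(1 / B)) = lam / mu := by
      have : Real.exp (-(1 / B)) = B * (lam / mu) := by
        nth_rewrite 2 [hB]
        field_simp
      rw [this]
      field_simp
    have hq1 : 1 / B ≤ 1 := by rw [div_le_one hB0]; exact hB1
    have hrB : r = 1 / B := by
      rcases lt_trichotomy r (1 / B) with hlt | heq | hlt
      · exact absurd (mul_exp_neg_lt_mul_exp_neg hlt hq1 (by positivity)) (by rw [hr, hq]; simp)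
      · exact heq
      · exact absurd (mul_exp_neg_lt_mul_exp_neg hlt hr1 hr0) (by rw [hr, hq]; simp)
    rw [hrB, one_div_one_div]
  refine ⟨fun k => ?_, ⟨A, hA⟩, ⟨B, hB⟩, ?_, ?_⟩
  · obtain ⟨h1, h2, h3⟩ := h.bounds k
    exact ⟨h1, h2.le, by rw [hbβ]; positivity⟩
  · intro hρ r hr0 hr1 hr _
    have hc : Real.exp 1 ≤ mu / lam := by
      have := inv_anti₀ (by positivity) hρ
      rwa [inv_inv, inv_div] at this
    obtain ⟨hα, B', hB1, hfix, hβ⟩ := h.tendsto_of_exp_one_le hc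
    refine ⟨hα, ?_⟩
    have := tendsto_b hβ
    rwa [eq_inv_of_fixed hr0 hr1 hr hB1 hfix, mul_one_div] at this
  · intro hρ x hx0 hx
    have hc : mu / lam ≤ Real.exp 1 := by
      have := inv_anti₀ (by positivity) hρ
      rwa [inv_inv, inv_div] at this
    rcases (le_one_of_mul_exp_le (hx.trans_le hc)).lt_or_eq with hx1 | rfl
    · obtain ⟨hα, hβ⟩ := h.tendsto_of_lt hx0 hx1 hx
      exact ⟨hα, by simpa using tendsto_b hβ⟩
    · rw [one_mul] at hx
      obtain ⟨hα, B', hB1, hfix, hβ⟩ := h.tendsto_of_exp_one_le hx.le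
      refine ⟨hα, ?_⟩
      have hr : (1 : ℝ) * Real.exp (-1) = lam / mu := by
        rw [one_mul, Real.exp_neg, hx, inv_div]
      have := tendsto_b hβ
      rwa [eq_inv_of_fixed one_pos le_rfl hr hB1 hfix, div_one, mul_one] at this
end
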